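/- Let n,m ≥ 1 and 1 ≤ i ≤ n. The map B_i is left adjoint to P_i: for all σ ∈ S_n, τ ∈ S_m and ρ ∈ S_{n+m−1}, one has B_i(σ,τ) ≤ ρ in the left weak order on S_{n+m−1} if and only if (σ,τ) ≤ P_i(ρ) in the product of the weak orders on S_n × S_m. -/

import Mathlib

open Equiv

/-- The one-line value (0-indexed) of a permutation of `Fin N`, extended to all of `ℕ`
by the identity.  Position `j` (0-indexed) carries the value `pv σ j` (0-indexed). -/
def pv {N : ℕ} (σ : Equiv.Perm (Fin N)) (j : ℕ) : ℕ :=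
  if h : j < N then (σ ⟨j, h⟩ : ℕ) else j

/-- The left weak (Bruhat) order on `S_N`: inclusion of inversion sets, where the
inversion set of `σ` is `{(p,q) | p < q ∧ σ p > σ q}`. -/
def wle {N : ℕ} (σ τ : Equiv.Perm (Fin N)) : Prop :=
  ∀ p q : Fin N, p < q → σ q < σ p → τ q < τ p

instance {N : ℕ} (σ τ : Equiv.Perm (Fin N)) : Decidable (wle σ τ) :=
  inferInstanceAs (Decidable (∀ p q : Fin N, p < q → σ q < σ p → τ q < τ p))

/-- The `a`-values of the insertion construction `B_i` (0-indexed values):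
`avv m s x = x` if `x < s` and `x + m - 1` otherwise. -/
def avv (m s x : ℕ) : ℕ := if x < s then x else x + m - 1

/-- The one-line values of the permutation `B_i(σ,τ) ∈ S_{n+m-1}`
(0-indexed position `i`, with `i < n`, and 0-indexed values). -/
def BFun {n m : ℕ} (i : ℕ) (σ : Equiv.Perm (Fin n)) (τ : Equiv.Perm (Fin m)) (j : ℕ) : ℕ :=
  if j < i then avv m (pv σ i) (pv σ j)
  else if j < i + m then pv τ (j - i) + pv σ i
  else avv m (pv σ i) (pv σ (j - m + 1))

/-- `ρ ∈ S_{n+m-1}` is the permutation `B_i(σ,τ)`. -/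
def IsB {n m : ℕ} (i : ℕ) (σ : Equiv.Perm (Fin n)) (τ : Equiv.Perm (Fin m))
    (ρ : Equiv.Perm (Fin (n + m - 1))) : Prop :=
  ∀ j : ℕ, j < n + m - 1 → pv ρ j = BFun i σ τ j

/-- `u^ρ`: the minimum of the entries of the middle block `L₂(ρ)` (positions `[i, i+m-1]`). -/
noncomputable def uPar {N : ℕ} (i m : ℕ) (ρ : Equiv.Perm (Fin N)) : ℕ :=
  sInf (pv ρ '' {p | i ≤ p ∧ p < i + m})

/-- `v^ρ`: the maximum of the entries of the middle block `L₂(ρ)`. -/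
noncomputable def vPar {N : ℕ} (i m : ℕ) (ρ : Equiv.Perm (Fin N)) : ℕ :=
  sSup (pv ρ '' {p | i ≤ p ∧ p < i + m})

/-- `C_{1,m}^ρ`: the entries of the first block of `ρ` lying strictly between `u^ρ` and `v^ρ`. -/
noncomputable def Cmid1 {N : ℕ} (i m : ℕ) (ρ : Equiv.Perm (Fin N)) : Set ℕ :=
  {x ∈ pv ρ '' {p | p < i} | uPar i m ρ < x ∧ x < vPar i m ρ}

/-- `C_{3,m}^ρ`: the entries of the third block of `ρ` lying strictly between `u^ρ` and `v^ρ`. -/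
noncomputable def Cmid3 {N : ℕ} (i m : ℕ) (ρ : Equiv.Perm (Fin N)) : Set ℕ :=
  {x ∈ pv ρ '' {p | i + m ≤ p ∧ p < N} | uPar i m ρ < x ∧ x < vPar i m ρ}

/-- The sequence `(Bρ(1),…,Bρ(i-1), w, Bρ(i+m),…,Bρ(n+m-1))` of length `n`,
used to produce the first component of `P_i(ρ)` by standardization (here `w = u + n₁`). -/
def concatFun {N : ℕ} (i m w : ℕ) (β : Equiv.Perm (Fin N)) (r : ℕ) : ℕ :=
  if r < i then pv β r else if r = i then w else pv β (r + m - 1)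

/-- `P_i(ρ) = (σ,τ)`: for `m = 1` this means `σ = ρ` and `τ = id`; for `m ≥ 2` it is
expressed via the intermediate permutation `Bρ` (denoted `β`), whose blocks standardize
like those of `ρ` and have the prescribed entry sets, `σ` being the standardization of
`(β(1),…,β(i-1), u+n₁, β(i+m),…,β(n+m-1))` and `τ` the standardization of `L₂(ρ)`. -/
noncomputable def IsP {n m : ℕ} (i : ℕ) (ρ : Equiv.Perm (Fin (n + m - 1)))
    (σ : Equiv.Perm (Fin n)) (τ : Equiv.Perm (Fin m)) : Prop :=
  if m = 1 then (∀ p : ℕ, pv σ p = pv ρ p) ∧ τ = 1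
  else
    ∃ β : Equiv.Perm (Fin (n + m - 1)),
      (∀ p q : ℕ, p < i → q < i → (pv β p < pv β q ↔ pv ρ p < pv ρ q)) ∧
      (∀ p q : ℕ, i ≤ p → p < i + m → i ≤ q → q < i + m →
        (pv β p < pv β q ↔ pv ρ p < pv ρ q)) ∧
      (∀ p q : ℕ, i + m ≤ p → p < n + m - 1 → i + m ≤ q → q < n + m - 1 →
        (pv β p < pv β q ↔ pv ρ p < pv ρ q)) ∧
      pv β '' {p | p < i} =
        {x ∈ pv ρ '' {p | p < i} | x < uPar i m ρ} ∪
          Set.Ico (uPar i m ρ) (uPar i m ρ + (Cmid1 i m ρ).ncard) ∪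
          {x ∈ pv ρ '' {p | p < i} | vPar i m ρ < x} ∧
      pv β '' {p | i ≤ p ∧ p < i + m} =
        Set.Icc (uPar i m ρ + (Cmid1 i m ρ).ncard) (vPar i m ρ - (Cmid3 i m ρ).ncard) ∧
      pv β '' {p | i + m ≤ p ∧ p < n + m - 1} =
        {x ∈ pv ρ '' {p | i + m ≤ p ∧ p < n + m - 1} | x < uPar i m ρ} ∪
          Set.Ioc (vPar i m ρ - (Cmid3 i m ρ).ncard) (vPar i m ρ) ∪
          {x ∈ pv ρ '' {p | i + m ≤ p ∧ p < n + m - 1} | vPar i m ρ < x} ∧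
      (∀ p q : Fin n, σ p < σ q ↔
        concatFun i m (uPar i m ρ + (Cmid1 i m ρ).ncard) β p <
          concatFun i m (uPar i m ρ + (Cmid1 i m ρ).ncard) β q) ∧
      (∀ p q : Fin m, τ p < τ q ↔ pv ρ (i + p) < pv ρ (i + q))

/-- In-range values of `pv` are in range. -/
lemma pv_lt {N : ℕ} (σ : Equiv.Perm (Fin N)) {j : ℕ} (hj : j < N) : pv σ j < N := by
  simp [pv, hj]

lemma pv_injective {N : ℕ} (σ : Equiv.Perm (Fin N)) {p q : ℕ} (hp : p < N) (hq : q < N)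
    (h : pv σ p = pv σ q) : p = q := by
  simpa [pv, hp, hq, Fin.val_inj] using h

/-- The weak order in terms of one-line values at natural-number positions. -/
lemma wle_iff_pv {N : ℕ} (σ τ : Equiv.Perm (Fin N)) :
    wle σ τ ↔ ∀ p q : ℕ, p < q → q < N → pv σ q < pv σ p → pv τ q < pv τ p := by
  constructor
  · intro h p q hpq hq
    have hp : p < N := hpq.trans hq
    simpa [pv, hp, hq] using h ⟨p, hp⟩ ⟨q, hq⟩ hpq
  · intro h p q hpq
    simpa [pv] using h p q hpq q.2

lemma avv_lt_avv_iff {m s x y : ℕ} (hm : 1 ≤ m) : avv m s x < avv m s y ↔ x < y := by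
  unfold avv
  split_ifs <;> omega

lemma add_lt_avv_iff {m s x k : ℕ} (hk : k < m) (hx : x ≠ s) : k + s < avv m s x ↔ s < x := by
  unfold avv
  split_ifs <;> omega

lemma avv_lt_add_iff {m s x k : ℕ} (hk : k < m) : avv m s x < k + s ↔ x < s := by
  unfold avv
  split_ifs <;> omega

lemma pv_lt_pv_iff_of_forall {N : ℕ} {τ : Equiv.Perm (Fin N)} {c : ℕ → ℕ}
    (h : ∀ p q : Fin N, τ p < τ q ↔ c p < c q) (p q : ℕ) (hp : p < N) (hq : q < N) :
    pv τ p < pv τ q ↔ c p < c q := by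
  simpa [pv, hp, hq] using h ⟨p, hp⟩ ⟨q, hq⟩

/-- If `f` and `g` are order isomorphic on `S`, and the image of `g` is obtained from that of `f`
by replacing the values in `[u, v]` by another subset `J` of `[u, v]`, then `g` agrees with `f`
wherever `f` takes values outside `[u, v]`, and takes values in `J` elsewhere. -/
lemma eq_or_mem_of_image_eq {S J : Set ℕ} {f g : ℕ → ℕ} {u v N : ℕ}
    (hfN : ∀ a ∈ S, f a < N) (hg : Set.InjOn g S)
    (hfg : ∀ p ∈ S, ∀ q ∈ S, (g p < g q ↔ f p < f q))
    (hJ : J ⊆ Set.Icc u v)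
    (him : g '' S = {x ∈ f '' S | x < u} ∪ J ∪ {x ∈ f '' S | v < x}) {a : ℕ} (ha : a ∈ S) :
    (f a < u ∧ g a = f a) ∨ (v < f a ∧ g a = f a) ∨ (u ≤ f a ∧ f a ≤ v ∧ g a ∈ J) := by
  have hmem : ∀ a ∈ S, (g a < u ∨ v < g a) → ∃ d ∈ S, f d = g a := by
    intro a ha h
    have h1 : g a ∈ g '' S := ⟨a, ha, rfl⟩
    rw [him] at h1
    rcases h1 with (h1 | h1) | h1
    · exact h1.1
    · have := hJ h1
      simp only [Set.mem_Icc] at this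
      omega
    · exact h1.1
  have hmem' : ∀ a ∈ S, (f a < u ∨ v < f a) → ∃ c ∈ S, g c = f a := by
    intro a ha h
    have : f a ∈ g '' S := by
      rw [him]
      rcases h with h | h
      · exact Or.inl (Or.inl ⟨⟨a, ha, rfl⟩, h⟩)
      · exact Or.inr ⟨⟨a, ha, rfl⟩, h⟩
    exact this
  have low : ∀ k, ∀ a ∈ S, f a = k → f a < u → g a = f a := by
    intro k
    induction k using Nat.strong_induction_on with
    | _ k ih =>
      intro a ha hk hu
      obtain ⟨c, hc, hca⟩ := hmem' a ha (Or.inl hu)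
      rcases lt_trichotomy (g c) (g a) with h | h | h
      · have h2 := (hfg c hc a ha).1 h
        have := ih (f c) (hk ▸ h2) c hc rfl (h2.trans hu)
        omega
      · omega
      · obtain ⟨d, hd, hda⟩ := hmem a ha (Or.inl (by omega))
        have := ih (f d) (by omega) d hd rfl (by omega)
        have : d = a := hg hd ha (by omega)
        subst this
        omega
  have high : ∀ k, ∀ a ∈ S, N - f a = k → v < f a → g a = f a := by
    intro k
    induction k using Nat.strong_induction_on with
    | _ k ih =>
      intro a ha hk hv
      have haN := hfN a ha
      obtain ⟨c, hc, hca⟩ := hmem' a ha (Or.inr hv)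
      rcases lt_trichotomy (g a) (g c) with h | h | h
      · have h2 := (hfg a ha c hc).1 h
        have := ih (N - f c) (by omega) c hc rfl (hv.trans h2)
        omega
      · omega
      · obtain ⟨d, hd, hda⟩ := hmem a ha (Or.inr (by omega))
        have := ih (N - f d) (by omega) d hd rfl (by omega)
        have : d = a := hg hd ha (by omega)
        subst this
        omega
  rcases lt_or_ge (f a) u with h | h
  · exact Or.inl ⟨h, low _ a ha rfl h⟩
  rcases lt_or_ge v (f a) with h' | h'
  · exact Or.inr (Or.inl ⟨h', high _ a ha rfl h'⟩)
  refine Or.inr (Or.inr ⟨h, h', ?_⟩)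
  have h1 : g a ∈ g '' S := ⟨a, ha, rfl⟩
  rw [him] at h1
  rcases h1 with (⟨⟨d, hd, hda⟩, h1⟩ | h1) | ⟨⟨d, hd, hda⟩, h1⟩
  · have := low _ d hd rfl (by omega)
    have : d = a := hg hd ha (by omega)
    subst this
    omega
  · exact h1
  · have := high _ d hd rfl (by omega)
    have : d = a := hg hd ha (by omega)
    subst this
    omega

section Middle

variable {N : ℕ} {i m : ℕ} (ρ : Equiv.Perm (Fin N))

lemma uPar_le {p : ℕ} (h1 : i ≤ p) (h2 : p < i + m) : uPar i m ρ ≤ pv ρ p :=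
  Nat.sInf_le ⟨p, ⟨h1, h2⟩, rfl⟩

lemma le_vPar {p : ℕ} (h1 : i ≤ p) (h2 : p < i + m) : pv ρ p ≤ vPar i m ρ :=
  le_csSup (((Set.finite_Ico i (i + m)).image _).bddAbove) ⟨p, ⟨h1, h2⟩, rfl⟩

lemma exists_pv_eq_uPar (hm : 1 ≤ m) : ∃ p, i ≤ p ∧ p < i + m ∧ pv ρ p = uPar i m ρ := by
  have hne : (pv ρ '' {p | i ≤ p ∧ p < i + m}).Nonempty := ⟨_, i, ⟨le_rfl, by omega⟩, rfl⟩
  obtain ⟨p, hp, h⟩ := Nat.sInf_mem hne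
  exact ⟨p, hp.1, hp.2, h⟩

lemma exists_pv_eq_vPar (hm : 1 ≤ m) : ∃ p, i ≤ p ∧ p < i + m ∧ pv ρ p = vPar i m ρ := by
  have hne : (pv ρ '' {p | i ≤ p ∧ p < i + m}).Nonempty := ⟨_, i, ⟨le_rfl, by omega⟩, rfl⟩
  obtain ⟨p, hp, h⟩ := Nat.sSup_mem hne (((Set.finite_Ico i (i + m)).image _).bddAbove)
  exact ⟨p, hp.1, hp.2, h⟩

end Middle

/-- `B_i(σ,τ) ≤ ρ` in the weak order, unfolded into conditions on the inversions of `σ` and `τ`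
according to the blocks containing the two positions. -/
lemma wle_of_isB_iff {n m : ℕ} (hm : 1 ≤ m) {i : ℕ} (hi : i < n)
    {σ : Equiv.Perm (Fin n)} {τ : Equiv.Perm (Fin m)} {ρ ρB : Equiv.Perm (Fin (n + m - 1))}
    (hB : IsB i σ τ ρB) :
    wle ρB ρ ↔
      (∀ p q, p < q → q < i → pv σ q < pv σ p → pv ρ q < pv ρ p) ∧
      (∀ p q, i < p → p < q → q < n → pv σ q < pv σ p → pv ρ (q + m - 1) < pv ρ (p + m - 1)) ∧
      (∀ p q, p < i → i < q → q < n → pv σ q < pv σ p → pv ρ (q + m - 1) < pv ρ p) ∧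
      (∀ p, p < i → pv σ i < pv σ p → vPar i m ρ < pv ρ p) ∧
      (∀ q, i < q → q < n → pv σ q < pv σ i → pv ρ (q + m - 1) < uPar i m ρ) ∧
      (∀ p q, p < q → q < m → pv τ q < pv τ p → pv ρ (i + q) < pv ρ (i + p)) := by
  have hB1 : ∀ p, p < i → pv ρB p = avv m (pv σ i) (pv σ p) := by
    intro p hp
    rw [hB p (by omega), BFun, if_pos hp]
  have hB2 : ∀ p, p < m → pv ρB (i + p) = pv τ p + pv σ i := by
    intro p hp
    rw [hB _ (by omega), BFun, if_neg (by omega), if_pos (by omega), Nat.add_sub_cancel_left]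
  have hB3 : ∀ p, i < p → p < n → pv ρB (p + m - 1) = avv m (pv σ i) (pv σ p) := by
    intro p hp hpn
    rw [hB _ (by omega), BFun, if_neg (by omega), if_neg (by omega)]
    congr 2
    omega
  have hne : ∀ p, p < n → p ≠ i → pv σ p ≠ pv σ i := fun p hp hpi h =>
    hpi (pv_injective σ hp hi h)
  rw [wle_iff_pv]
  constructor
  · intro h
    refine ⟨?_, ?_, ?_, ?_, ?_, ?_⟩
    · intro p q hpq hq hs
      refine h p q hpq (by omega) ?_
      rwa [hB1 p (by omega), hB1 q hq, avv_lt_avv_iff hm]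
    · intro p q hp hpq hq hs
      refine h _ _ (by omega) (by omega) ?_
      rwa [hB3 p hp (by omega), hB3 q (by omega) hq, avv_lt_avv_iff hm]
    · intro p q hp hq hqn hs
      refine h _ _ (by omega) (by omega) ?_
      rwa [hB1 p hp, hB3 q hq hqn, avv_lt_avv_iff hm]
    · intro p hp hs
      obtain ⟨q, hq1, hq2, hq⟩ := exists_pv_eq_vPar (i := i) ρ hm
      rw [← hq]
      refine h p q (by omega) (by omega) ?_
      obtain ⟨k, rfl⟩ := Nat.exists_eq_add_of_le hq1
      rw [hB1 p hp, hB2 k (by omega),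
        add_lt_avv_iff (pv_lt τ (by omega)) (hne p (by omega) (by omega))]
      exact hs
    · intro q hq hqn hs
      obtain ⟨p, hp1, hp2, hp⟩ := exists_pv_eq_uPar (i := i) ρ hm
      rw [← hp]
      refine h p _ (by omega) (by omega) ?_
      obtain ⟨k, rfl⟩ := Nat.exists_eq_add_of_le hp1
      rw [hB3 q hq hqn, hB2 k (by omega), avv_lt_add_iff (pv_lt τ (by omega))]
      exact hs
    · intro p q hpq hq ht
      refine h _ _ (by omega) (by omega) ?_
      rw [hB2 p (by omega), hB2 q hq]
      omega
  · rintro ⟨h1, h2, h3, h4, h5, h6⟩ p q hpq hq hs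
    have split : ∀ p, p < n + m - 1 →
        p < i ∨ (∃ k < m, p = i + k) ∨ (∃ k, i < k ∧ k < n ∧ p = k + m - 1) := by
      intro p hp
      rcases lt_or_ge p i with h | h
      · exact Or.inl h
      rcases lt_or_ge p (i + m) with h' | h'
      · exact Or.inr (Or.inl ⟨p - i, by omega, by omega⟩)
      · exact Or.inr (Or.inr ⟨p + 1 - m, by omega, by omega, by omega⟩)
    rcases split p (by omega) with hp | ⟨k, hk, rfl⟩ | ⟨k, hk, hkn, rfl⟩ <;>
      rcases split q hq with hq | ⟨l, hl, rfl⟩ | ⟨l, hl, hln, rfl⟩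
    · rw [hB1 p hp, hB1 q hq, avv_lt_avv_iff hm] at hs
      exact h1 p q hpq hq hs
    · rw [hB1 p hp, hB2 l hl,
        add_lt_avv_iff (pv_lt τ hl) (hne p (by omega) (by omega))] at hs
      exact (le_vPar ρ (by omega) (by omega)).trans_lt (h4 p hp hs)
    · rw [hB1 p hp, hB3 l hl hln, avv_lt_avv_iff hm] at hs
      exact h3 p l hp hl hln hs
    · omega
    · rw [hB2 k hk, hB2 l hl] at hs
      exact h6 k l (by omega) hl (by omega)
    · rw [hB2 k hk, hB3 l hl hln, avv_lt_add_iff (pv_lt τ (by omega))] at hs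
      exact (h5 l hl hln hs).trans_le (uPar_le ρ (by omega) (by omega))
    · omega
    · omega
    · rw [hB3 k hk hkn, hB3 l hl hln, avv_lt_avv_iff hm] at hs
      exact h2 k l hk (by omega) hln hs

/-- **Theorem.** `B_i` is left adjoint to `P_i`: `B_i(σ,τ) ≤ ρ` in the weak order on
`S_{n+m-1}` iff `(σ,τ) ≤ P_i(ρ)` in the product of the weak orders on `S_n × S_m`. -/
theorem B_leftAdjoint_P {n m : ℕ} (hn : 1 ≤ n) (hm : 1 ≤ m) (i : ℕ) (hi : i < n)
    (σ : Equiv.Perm (Fin n)) (τ : Equiv.Perm (Fin m))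
    (ρ ρB : Equiv.Perm (Fin (n + m - 1)))
    (σ' : Equiv.Perm (Fin n)) (τ' : Equiv.Perm (Fin m))
    (hB : IsB i σ τ ρB) (hP : IsP i ρ σ' τ') :
    wle ρB ρ ↔ (wle σ σ' ∧ wle τ τ') := by
  by_cases hm1 : m = 1
  · subst hm1
    rw [IsP, if_pos rfl] at hP
    have hBσ : ∀ j, j < n → pv ρB j = pv σ j := by
      intro j hj
      have hτ : pv τ 0 = 0 := by have := pv_lt τ (j := 0) one_pos; omega
      rw [hB j (by omega), BFun]
      rcases lt_trichotomy j i with h | rfl | h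
      · rw [if_pos h, avv, Nat.add_sub_cancel, ite_self]
      · rw [if_neg (lt_irrefl j), if_pos (by omega), Nat.sub_self, hτ, zero_add]
      · rw [if_neg (by omega), if_neg (by omega), avv, Nat.add_sub_cancel, ite_self]
        congr 1
        omega
    have hτ : wle τ τ' := by
      intro p q hpq
      omega
    rw [and_iff_left hτ, wle_iff_pv, wle_iff_pv]
    refine forall₂_congr fun p q => forall_congr' fun hpq => ?_
    rw [hP.1 p, hP.1 q]
    change (q < n → _) ↔ (q < n → _)
    refine forall_congr' fun hq => ?_
    rw [hBσ p (by omega), hBσ q hq]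
  rw [IsP, if_neg hm1] at hP
  obtain ⟨β, hβ1, -, hβ3, him1, him2, him3, hσ', hτ'⟩ := hP
  rw [wle_of_isB_iff hm hi hB]
  have hσ'' := pv_lt_pv_iff_of_forall hσ'
  have hτ'' := pv_lt_pv_iff_of_forall (c := fun p => pv ρ (i + p)) hτ'
  have hmid : uPar i m ρ + (Cmid1 i m ρ).ncard ≤ vPar i m ρ - (Cmid3 i m ρ).ncard := by
    have : pv β i ∈ pv β '' {p | i ≤ p ∧ p < i + m} := ⟨i, ⟨le_rfl, by omega⟩, rfl⟩
    rw [him2] at this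
    exact this.1.trans this.2
  have key1 := fun a (ha : a < i) => eq_or_mem_of_image_eq (N := n + m - 1)
    (fun a (ha : a < i) => pv_lt ρ (by omega))
    (fun a (ha : a < i) b (hb : b < i) h => pv_injective β (by omega) (by omega) h)
    (fun p hp q hq => hβ1 p q hp hq)
    (fun x hx => by simp only [Set.mem_Ico, Set.mem_Icc] at hx ⊢; omega) him1 ha
  have key3 := fun a (ha : i < a) (han : a < n) => eq_or_mem_of_image_eq (N := n + m - 1)
    (S := {p | i + m ≤ p ∧ p < n + m - 1}) (a := a + m - 1)
    (fun a ha => pv_lt ρ ha.2)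
    (fun a ha b hb h => pv_injective β ha.2 hb.2 h)
    (fun p hp q hq => hβ3 p q hp.1 hp.2 hq.1 hq.2)
    (fun x hx => by simp only [Set.mem_Ioc, Set.mem_Icc] at hx ⊢; omega) him3
    ⟨by omega, by omega⟩
  simp only [Set.mem_Ico, Set.mem_Ioc] at key1 key3
  set u := uPar i m ρ
  set v := vPar i m ρ
  set n₁ := (Cmid1 i m ρ).ncard
  set n₃ := (Cmid3 i m ρ).ncard
  have hc1 : ∀ p, p < i → concatFun i m (u + n₁) β p = pv β p := fun p hp => if_pos hp
  have hc2 : concatFun i m (u + n₁) β i = u + n₁ := by simp [concatFun]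
  have hc3 : ∀ p, i < p → concatFun i m (u + n₁) β p = pv β (p + m - 1) := by
    intro p hp
    rw [concatFun, if_neg (by omega), if_neg (by omega)]
  rw [wle_iff_pv, wle_iff_pv]
  constructor
  · rintro ⟨h1, h2, h3, h4, h5, h6⟩
    constructor
    · intro p q hpq hq hs
      rw [hσ'' q p hq (by omega)]
      rcases lt_trichotomy p i with hp | rfl | hp
      · rcases lt_trichotomy q i with hqi | rfl | hqi
        · rw [hc1 p hp, hc1 q hqi, hβ1 q p hqi hp]
          exact h1 p q hpq hqi hs
        · rw [hc1 p hp, hc2]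
          have := h4 p hp hs
          have := key1 p hp
          omega
        · rw [hc1 p hp, hc3 q hqi]
          have := key1 p hp
          have := key3 q hqi hq
          have := h3 p q hp hqi hq hs
          rcases lt_or_ge (pv σ i) (pv σ p) with h | h
          · have := h4 p hp h
            omega
          · have := h5 q hqi hq (by omega)
            omega
      · rw [hc2, hc3 q hpq]
        have := h5 q hpq hq hs
        have := key3 q hpq hq
        omega
      · rw [hc3 p hp, hc3 q (by omega),
          hβ3 _ _ (by omega) (by omega) (by omega) (by omega)]
        exact h2 p q hp hpq hq hs
    · intro p q hpq hq hs
      rw [hτ'' q p hq (by omega)]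
      exact h6 p q hpq hq hs
  · rintro ⟨hσ, hτ⟩
    have hσ : ∀ p q, p < q → q < n → pv σ q < pv σ p →
        concatFun i m (u + n₁) β q < concatFun i m (u + n₁) β p := by
      intro p q hpq hq hs
      rw [← hσ'' q p hq (by omega)]
      exact hσ p q hpq hq hs
    have h4 : ∀ p, p < i → pv σ i < pv σ p → v < pv ρ p := by
      intro p hp hs
      have := hσ p i hp hi hs
      rw [hc1 p hp, hc2] at this
      have := key1 p hp
      omega
    have h5 : ∀ q, i < q → q < n → pv σ q < pv σ i → pv ρ (q + m - 1) < u := by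
      intro q hq hqn hs
      have := hσ i q hq hqn hs
      rw [hc3 q hq, hc2] at this
      have := key3 q hq hqn
      omega
    refine ⟨?_, ?_, ?_, h4, h5, ?_⟩
    · intro p q hpq hq hs
      rw [← hβ1 q p hq (by omega), ← hc1 p (by omega), ← hc1 q hq]
      exact hσ p q hpq (by omega) hs
    · intro p q hp hpq hq hs
      rw [← hβ3 _ _ (by omega) (by omega) (by omega) (by omega), ← hc3 p hp,
        ← hc3 q (by omega)]
      exact hσ p q hpq hq hs
    · intro p q hp hq hqn hs
      have hc := hσ p q (by omega) hqn hs
      rw [hc1 p hp, hc3 q hq] at hc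
      have := key1 p hp
      have := key3 q hq hqn
      rcases lt_or_ge (pv σ i) (pv σ p) with h | h
      · have := h4 p hp h
        omega
      · have := h5 q hq hqn (by omega)
        omega
    · intro p q hpq hq hs
      exact (hτ'' q p hq (by omega)).1 (hτ p q hpq hq hs)
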